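/- Let P > 0 and N > 0, and let X̃ ~ N(0, P) and Z̃ ~ N(0, N) be independent real-valued Gaussian random variables. Define the ZMod 2-valued random variables U = Q_b(X̃) (equal to 1 if X̃ < 0, else 0) and V = Q_b(X̃ + Z̃) (equal to 1 if X̃ + Z̃ < 0, else 0), and set Z' = V - U (subtraction in ZMod 2). Then U is uniform on ZMod 2, and Z' is independent of U. -/

import Mathlib

open MeasureTheory ProbabilityTheory
open scoped NNReal ENNReal

/-- If swapping the two values of a `ZMod 2`-valued random variable `f` does not change its joint
law with `g`, then `f` is uniform and independent of `g`. -/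
lemma uniform_and_indepFun_of_measure_inter_eq {Ω β : Type*} [MeasurableSpace Ω]
    [MeasurableSpace β] {P : Measure Ω} [IsProbabilityMeasure P] {f : Ω → ZMod 2} {g : Ω → β}
    (hf : Measurable f)
    (h : ∀ s, MeasurableSet s → P (f ⁻¹' {0} ∩ g ⁻¹' s) = P (f ⁻¹' {1} ∩ g ⁻¹' s)) :
    (∀ u : ZMod 2, P {ω | f ω = u} = 1 / 2) ∧ IndepFun f g P := by
  have hcompl : (f ⁻¹' {0})ᶜ = f ⁻¹' {1} := by
    ext ω
    simp only [Set.mem_compl_iff, Set.mem_preimage, Set.mem_singleton_iff]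
    generalize f ω = u
    revert u
    decide
  have hhalf : ∀ s, MeasurableSet s → ∀ u : ZMod 2,
      P (f ⁻¹' {u} ∩ g ⁻¹' s) = 1 / 2 * P (g ⁻¹' s) := by
    intro s hs
    have hsum : P (f ⁻¹' {0} ∩ g ⁻¹' s) + P (f ⁻¹' {1} ∩ g ⁻¹' s) = P (g ⁻¹' s) := by
      rw [← hcompl, Set.inter_comm, Set.inter_comm _ (g ⁻¹' s), ← Set.sdiff_eq]
      exact measure_inter_add_sdiff _ (hf (measurableSet_singleton 0))
    have h0 : P (f ⁻¹' {0} ∩ g ⁻¹' s) = 1 / 2 * P (g ⁻¹' s) := by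
      rw [← hsum, ← h s hs, ← two_mul, ← mul_assoc, one_div,
        ENNReal.inv_mul_cancel two_ne_zero ENNReal.ofNat_ne_top, one_mul]
    intro u
    fin_cases u
    · exact h0
    · exact (h s hs).symm.trans h0
  have hunif : ∀ u : ZMod 2, P (f ⁻¹' {u}) = 1 / 2 := by
    intro u
    simpa using hhalf Set.univ MeasurableSet.univ u
  refine ⟨hunif, indepFun_iff_measure_inter_preimage_eq_mul.2 fun A s _ hs => ?_⟩
  have hA : A = ∅ ∨ A = {0} ∨ A = {1} ∨ A = Set.univ := by
    have huniv : ∀ u : ZMod 2, u = 0 ∨ u = 1 := by decide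
    by_cases h0 : (0 : ZMod 2) ∈ A <;> by_cases h1 : (1 : ZMod 2) ∈ A
    · exact Or.inr <| Or.inr <| Or.inr <| by ext u; rcases huniv u with rfl | rfl <;> simp [h0, h1]
    · exact Or.inr <| Or.inl <| by ext u; rcases huniv u with rfl | rfl <;> simp [h0, h1]
    · exact Or.inr <| Or.inr <| Or.inl <| by ext u; rcases huniv u with rfl | rfl <;> simp [h0, h1]
    · exact Or.inl <| by ext u; rcases huniv u with rfl | rfl <;> simp [h0, h1]
  rcases hA with rfl | rfl | rfl | rfl
  · simp
  · rw [hunif, hhalf s hs]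
  · rw [hunif, hhalf s hs]
  · simp

lemma ae_ne_of_map_eq_gaussianReal {Ω : Type*} [MeasurableSpace Ω] {P : Measure Ω} {X : Ω → ℝ}
    {m : ℝ} {v : ℝ≥0} (hX : Measurable X) (hmap : P.map X = gaussianReal m v) (hv : v ≠ 0)
    (x : ℝ) : ∀ᵐ ω ∂P, X ω ≠ x := by
  have := nullSingletonClass_gaussianReal (μ := m) hv
  have hx : ∀ᵐ y ∂(P.map X), y ≠ x := by
    rw [hmap]
    exact Measure.ae_ne _ x
  exact ae_of_ae_map hX.aemeasurable hx

lemma identDistrib_neg_of_map_eq_gaussianReal {Ω : Type*} [MeasurableSpace Ω] {P : Measure Ω}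
    {X : Ω → ℝ} {v : ℝ≥0} (hX : Measurable X) (hmap : P.map X = gaussianReal 0 v) :
    IdentDistrib X (-X) P P where
  aemeasurable_fst := hX.aemeasurable
  aemeasurable_snd := hX.neg.aemeasurable
  map_eq := by
    have hcomp : P.map (-X) = (P.map X).map (fun x => -x) :=
      (Measure.map_map measurable_neg hX).symm
    rw [hcomp, hmap, gaussianReal_map_neg, neg_zero]

/-- Let `X̃ ~ N(0,P)` and `Z̃ ~ N(0,N)` be independent Gaussians with
`P, N > 0`.  With the binary quantizer `Q_b` (value `1` if the input is negative, `0`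
otherwise), set `U = Q_b(X̃)`, `V = Q_b(X̃ + Z̃)` and `Z' = V - U` in `ZMod 2`.
Then `U` is uniform on `ZMod 2` and `Z'` is independent of `U`. -/
theorem quantized_puf_noise_indep
    {Ω : Type*} [MeasurableSpace Ω] (P : Measure Ω) [IsProbabilityMeasure P]
    (Pv Nv : ℝ≥0) (hPv : 0 < Pv) (hNv : 0 < Nv)
    (X Z : Ω → ℝ) (hX : Measurable X) (hZ : Measurable Z)
    (hmapX : P.map X = gaussianReal 0 Pv)
    (hmapZ : P.map Z = gaussianReal 0 Nv)
    (hXZ : IndepFun X Z P)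
    (U V Z' : Ω → ZMod 2)
    (hU : U = fun ω => if X ω < 0 then 1 else 0)
    (hV : V = fun ω => if X ω + Z ω < 0 then 1 else 0)
    (hZ' : Z' = V - U) :
    (∀ u : ZMod 2, P {ω | U ω = u} = 1 / 2) ∧ IndepFun U Z' P := by
  have hident : IdentDistrib (fun ω => (X ω, Z ω)) (fun ω => ((-X) ω, (-Z) ω)) P P :=
    (identDistrib_neg_of_map_eq_gaussianReal hX hmapX).prodMk
      (identDistrib_neg_of_map_eq_gaussianReal hZ hmapZ) hXZ
      (hXZ.comp measurable_neg measurable_neg)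
  have hX0 := ae_ne_of_map_eq_gaussianReal hX hmapX hPv.ne' 0
  have hXZ0 := ae_ne_of_map_eq_gaussianReal (hX.add hZ)
    (gaussianReal_add_gaussianReal_of_indepFun hXZ hmapX hmapZ) (add_pos hPv hNv).ne' 0
  let q : ℝ → ZMod 2 := fun x => if x < 0 then 1 else 0
  have hq : Measurable q := Measurable.ite measurableSet_Iio measurable_const measurable_const
  have hq_neg : ∀ x, x ≠ 0 → q (-x) = q x + 1 := by
    intro x hx
    rcases hx.lt_or_gt with h | h
    · simp only [q, Left.neg_neg_iff, h, h.not_gt, if_true, if_false]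
      decide
    · simp [q, h, h.not_gt]
  have hUq : U = fun ω => q (X ω) := hU
  have hVq : V = fun ω => q (X ω + Z ω) := hV
  subst hZ' hUq hVq
  refine uniform_and_indepFun_of_measure_inter_eq (hq.comp hX) fun s hs => ?_
  let A : Set (ℝ × ℝ) := {p | q p.1 = 0 ∧ q (p.1 + p.2) - q p.1 ∈ s}
  have hA : MeasurableSet A :=
    ((hq.comp measurable_fst) (measurableSet_singleton 0)).inter
      (((hq.comp (measurable_fst.add measurable_snd)).sub (hq.comp measurable_fst)) hs)
  refine (hident.measure_mem_eq hA).trans (measure_congr ?_)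
  filter_upwards [hX0, hXZ0] with ω h1 h2
  have hflip : ∀ u : ZMod 2, u + 1 = 0 ↔ u = 1 := by decide
  apply propext
  change (q (-X ω) = 0 ∧ q (-X ω + -Z ω) - q (-X ω) ∈ s) ↔
    (q (X ω) = 1 ∧ q (X ω + Z ω) - q (X ω) ∈ s)
  rw [← neg_add, hq_neg _ h1, hq_neg (X ω + Z ω) h2, add_sub_add_right_eq_sub, hflip]
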